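/- arXiv:1002.4711 — 2 statements merged into one kernel-verified Lean document; each statement's English description precedes it below -/
import Mathlib

section
/- Let A be a C*-algebra acting on a Hilbert space H. Then any two central annihilators commute as elements of the lattice 𝒫: for all X, Y ∈ Z(𝒫), one has X = (X ∧ Y) ∨ (X ∧ Ann(Y)). -/
/-- The annihilator of a set `S`: elements anticommuting with every member of `S`. -/
def Ann {A : Type*} [NonUnitalNonAssocRing A] (S : Set A) : Set A :=
  {a : A | ∀ s ∈ S, a * s + s * a = 0}

/-- `ᵈV = {a ∈ A : x a y + y a x = 0 for all x, y ∈ V}`. -/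
def dAnn {A : Type*} [NonUnitalNonAssocRing A] (V : Set A) : Set A :=
  {a : A | ∀ x ∈ V, ∀ y ∈ V, x * a * y + y * a * x = 0}

/-- The set `𝒫` of annihilators: sets of the form `Ann (Ann S)` with `S ⊆ A₊`. -/
def PAnn (A : Type*) [NonUnitalNonAssocRing A] [PartialOrder A] : Set (Set A) :=
  {V | ∃ S : Set A, (∀ s ∈ S, 0 ≤ s) ∧ V = Ann (Ann S)}

/-- A central annihilator: `V = Ann (Ann S)` with `S ⊆ A₊` and
`ᵈ(Ann (Ann S)) ∩ ᵈ(Ann S) = {0}`. -/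
def IsCentralAnn {A : Type*} [NonUnitalNonAssocRing A] [PartialOrder A] (V : Set A) : Prop :=
  ∃ S : Set A, (∀ s ∈ S, 0 ≤ s) ∧ V = Ann (Ann S) ∧
    dAnn (Ann (Ann S)) ∩ dAnn (Ann S) = {0}

/-- `V` is the least upper bound of the family `T` within the collection `P` (ordered by `⊆`). -/
def IsLUBIn {α : Type*} (P T : Set (Set α)) (V : Set α) : Prop :=
  V ∈ P ∧ (∀ W ∈ T, W ⊆ V) ∧ ∀ U ∈ P, (∀ W ∈ T, W ⊆ U) → V ⊆ U

/-- `V` is the greatest lower bound of the family `T` within the collection `P`. -/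
def IsGLBIn {α : Type*} (P T : Set (Set α)) (V : Set α) : Prop :=
  V ∈ P ∧ (∀ W ∈ T, V ⊆ W) ∧ ∀ U ∈ P, (∀ W ∈ T, U ⊆ W) → U ⊆ V

section MulAnnihilator

variable {A : Type*} [NonUnitalCStarAlgebra A]

lemma mul_eq_zero_of_nonneg_of_anticommute [PartialOrder A] [StarOrderedRing A] {a s : A}
    (hs : 0 ≤ s) (h : a * s + s * a = 0) : a * s = 0 ∧ s * a = 0 := by
  have h₁ : a * s = -(s * a) := eq_neg_of_add_eq_zero_left h
  have hsq : Commute (s * s) a := by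
    change s * s * a = a * (s * s)
    rw [← mul_assoc, h₁, neg_mul, mul_assoc s a s, h₁, mul_neg, neg_neg, mul_assoc]
  have hc : Commute s a := by
    have := hsq.cfcₙ_nnreal NNReal.sqrt
    rwa [← CFC.sqrt, CFC.sqrt_mul_self s hs] at this
  have hz : (2 : ℂ) • (a * s) = 0 := by rw [two_smul]; nth_rw 2 [← hc.eq]; exact h
  have hz' : a * s = 0 := (smul_eq_zero.1 hz).resolve_left two_ne_zero
  exact ⟨hz', hc.eq.trans hz'⟩

lemma mem_Ann_iff_of_nonneg [PartialOrder A] [StarOrderedRing A] {S : Set A}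
    (hS : ∀ s ∈ S, 0 ≤ s) {a : A} : a ∈ Ann S ↔ ∀ s ∈ S, a * s = 0 ∧ s * a = 0 :=
  ⟨fun h s hs ↦ mul_eq_zero_of_nonneg_of_anticommute (hS s hs) (h s hs),
    fun h s hs ↦ by simp [h s hs]⟩

lemma star_mem_Ann_of_nonneg [PartialOrder A] [StarOrderedRing A] {S : Set A}
    (hS : ∀ s ∈ S, 0 ≤ s) {a : A} (ha : a ∈ Ann S) : star a ∈ Ann S := by
  intro s hs
  simpa [(IsSelfAdjoint.of_nonneg (hS s hs)).star_eq, add_comm] using congr_arg star (ha s hs)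

lemma mul_mem_Ann_of_nonneg [PartialOrder A] [StarOrderedRing A] {S : Set A}
    (hS : ∀ s ∈ S, 0 ≤ s) {a b : A} (ha : a ∈ Ann S) (hb : b ∈ Ann S) : a * b ∈ Ann S := by
  rw [mem_Ann_iff_of_nonneg hS] at *
  intro s hs
  rw [mul_assoc, (hb s hs).1, ← mul_assoc s, (ha s hs).2, mul_zero, zero_mul]
  exact ⟨rfl, rfl⟩

lemma mem_Ann_Ann_iff [PartialOrder A] [StarOrderedRing A] {S : Set A}
    (hS : ∀ s ∈ S, 0 ≤ s) {a : A} :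
    a ∈ Ann (Ann S) ↔ ∀ b ∈ Ann S, a * b = 0 ∧ b * a = 0 := by
  refine ⟨fun h b hb ↦ ?_, fun h b hb ↦ by simp [h b hb]⟩
  have hb' := star_mem_Ann_of_nonneg hS hb
  have h₁ := (mul_eq_zero_of_nonneg_of_anticommute (mul_star_self_nonneg b)
    (h _ (mul_mem_Ann_of_nonneg hS hb hb'))).1
  have h₂ := (mul_eq_zero_of_nonneg_of_anticommute (star_mul_self_nonneg b)
    (h _ (mul_mem_Ann_of_nonneg hS hb' hb))).2
  constructor
  · rw [← CStarRing.mul_star_self_eq_zero_iff, star_mul, mul_assoc, ← mul_assoc b,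
      ← mul_assoc, h₁, zero_mul]
  · rw [← CStarRing.star_mul_self_eq_zero_iff, star_mul, mul_assoc, ← mul_assoc (star b),
      h₂, mul_zero]

lemma star_mem_Ann_Ann [PartialOrder A] [StarOrderedRing A] {S : Set A}
    (hS : ∀ s ∈ S, 0 ≤ s) {a : A} (ha : a ∈ Ann (Ann S)) : star a ∈ Ann (Ann S) := by
  intro b hb
  simpa [add_comm] using congr_arg star (ha _ (star_mem_Ann_of_nonneg hS hb))

lemma mul_mul_mem_Ann_Ann [PartialOrder A] [StarOrderedRing A] {S : Set A}
    (hS : ∀ s ∈ S, 0 ≤ s) {a b : A} (ha : a ∈ Ann (Ann S)) (hb : b ∈ Ann (Ann S)) (c : A) :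
    a * c * b ∈ Ann (Ann S) := by
  rw [mem_Ann_Ann_iff hS] at *
  intro s hs
  rw [mul_assoc, (hb s hs).1, mul_assoc a c b, ← mul_assoc s, (ha s hs).2, mul_zero, zero_mul]
  exact ⟨rfl, rfl⟩

end MulAnnihilator

lemma Ann_antitone {A : Type*} [NonUnitalNonAssocRing A] {S T : Set A} (h : S ⊆ T) :
    Ann T ⊆ Ann S :=
  fun _ ha s hs ↦ ha s (h hs)

lemma subset_Ann_Ann {A : Type*} [NonUnitalNonAssocRing A] (S : Set A) : S ⊆ Ann (Ann S) :=
  fun s hs a ha ↦ by rw [add_comm]; exact ha s hs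

lemma Ann_Ann_Ann {A : Type*} [NonUnitalNonAssocRing A] (S : Set A) :
    Ann (Ann (Ann S)) = Ann S :=
  (Ann_antitone (subset_Ann_Ann S)).antisymm (subset_Ann_Ann (Ann S))

lemma mem_of_isGLBIn_pair {A : Type*} [NonUnitalNonAssocRing A] [PartialOrder A]
    {S T M : Set A} (hM : IsGLBIn (PAnn A) {Ann S, Ann T} M) {z : A} (hz : 0 ≤ z)
    (hzS : z ∈ Ann S) (hzT : z ∈ Ann T) : z ∈ M := by
  have key (R : Set A) (hR : z ∈ Ann R) : Ann (Ann {z}) ⊆ Ann R := by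
    rw [← Ann_Ann_Ann R]
    exact Ann_antitone (Ann_antitone (Set.singleton_subset_iff.2 hR))
  refine hM.2.2 (Ann (Ann {z})) ⟨{z}, by simpa using hz, rfl⟩ ?_ (subset_Ann_Ann _ rfl)
  rintro W (rfl | rfl)
  exacts [key S hzS, key T hzT]

/-- A central annihilator and its complement are orthogonal as ideals. -/
lemma mul_mul_eq_zero_of_central {A : Type*} [NonUnitalCStarAlgebra A] [PartialOrder A]
    [StarOrderedRing A] {S : Set A} (hS : ∀ s ∈ S, 0 ≤ s)
    (h : dAnn (Ann (Ann S)) ∩ dAnn (Ann S) = {0}) {v w : A} (hv : v ∈ Ann (Ann S))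
    (hw : w ∈ Ann S) (a : A) : v * a * w = 0 := by
  rw [← Set.mem_singleton_iff, ← h]
  constructor
  · have key (x y : A) (hy : y ∈ Ann (Ann S)) : x * (v * a * w) * y = 0 := by
      rw [mul_assoc, mul_assoc (v * a), ((mem_Ann_Ann_iff hS).1 hy w hw).2, mul_zero, mul_zero]
    intro x hx y hy
    rw [key x y hy, key y x hx, add_zero]
  · have key (x y : A) (hx : x ∈ Ann S) : x * (v * a * w) * y = 0 := by
      rw [mul_assoc v, ← mul_assoc x, ((mem_Ann_Ann_iff hS).1 hv x hx).2, zero_mul, zero_mul]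
    intro x hx y hy
    rw [key x y hx, key y x hy, add_zero]

/-- Central annihilators commute in the lattice `𝒫`:
for central `X, Y`, `X = (X ∧ Y) ∨ (X ∧ Ann Y)`. -/
theorem stmt_6 {A : Type*} [NonUnitalCStarAlgebra A] [PartialOrder A] [StarOrderedRing A]
    (X Y : Set A) (hX : IsCentralAnn X) (hY : IsCentralAnn Y) :
    ∀ M₁ M₂ J : Set A, IsGLBIn (PAnn A) {X, Y} M₁ → IsGLBIn (PAnn A) {X, Ann Y} M₂ →
      IsLUBIn (PAnn A) {M₁, M₂} J → X = J := by
  rintro M₁ M₂ J hM₁ hM₂ ⟨⟨U, hU, rfl⟩, hMJ, hJ⟩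
  obtain ⟨S, hS, rfl, -⟩ := hX
  obtain ⟨T, hT, rfl, hc⟩ := hY
  rw [Ann_Ann_Ann] at hM₂
  refine Set.Subset.antisymm ?_ (hJ _ ⟨S, hS, rfl⟩ ?_)
  · have hz {x : A} (hx : x ∈ Ann (Ann S)) (w : A) :
        x * w * star (x * w) ∈ Ann (Ann S) := by
      have := mul_mul_mem_Ann_Ann hS hx (star_mem_Ann_Ann hS hx) (w * star w)
      rwa [star_mul, mul_assoc, ← mul_assoc w, ← mul_assoc]
    have hYY {v w : A} (hv : v ∈ Ann (Ann T)) (hw : w ∈ Ann T) (a : A) : v * (a * w) = 0 := by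
      rw [← mul_assoc, mul_mul_eq_zero_of_central hT hc hv hw]
    have hYY' {v w : A} (hv : v ∈ Ann (Ann T)) (hw : w ∈ Ann T) (a : A) : w * (a * v) = 0 := by
      simpa [mul_assoc] using congr_arg star
        (hYY (star_mem_Ann_Ann hT hv) (star_mem_Ann_of_nonneg hT hw) (star a))
    have hz₁ {x w : A} (hx : x ∈ Ann (Ann S)) (hw : w ∈ Ann (Ann T)) :
        x * w * star (x * w) ∈ Ann (Ann U) := by
      refine hMJ M₁ (by simp) (mem_of_isGLBIn_pair hM₁ (mul_star_self_nonneg _) (hz hx w) ?_)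
      intro b hb
      rw [star_mul, mul_assoc, mul_assoc (star w), hYY (star_mem_Ann_Ann hT hw) hb, mul_zero,
        ← mul_assoc b, hYY' hw hb, zero_mul, add_zero]
    have hz₂ {x w : A} (hx : x ∈ Ann (Ann S)) (hw : w ∈ Ann T) :
        x * w * star (x * w) ∈ Ann (Ann U) := by
      refine hMJ M₂ (by simp) (mem_of_isGLBIn_pair hM₂ (mul_star_self_nonneg _) (hz hx w) ?_)
      intro b hb
      have hb' := subset_Ann_Ann T hb
      rw [star_mul, mul_assoc, mul_assoc (star w), hYY' hb' (star_mem_Ann_of_nonneg hT hw),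
        mul_zero, ← mul_assoc b, hYY hb' hw, zero_mul, add_zero]
    have hw {x b w : A} (hb : b ∈ Ann U) (h : x * w * star (x * w) ∈ Ann (Ann U)) :
        b * x * w = 0 := by
      rw [← CStarRing.mul_star_self_eq_zero_iff, mul_assoc b, star_mul b, ← mul_assoc,
        mul_assoc b, ((mem_Ann_Ann_iff hU).1 h b hb).2, zero_mul]
    have hmul {x b : A} (hx : x ∈ Ann (Ann S)) (hb : b ∈ Ann U) : b * x = 0 := by
      have hc₁ : star (b * x) * (b * x) ∈ Ann T := by
        rw [← Ann_Ann_Ann]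
        intro w hwT
        have h₁ := hw hb (hz₁ hx hwT)
        have h₂ := hw hb (hz₁ hx (star_mem_Ann_Ann hT hwT))
        have h₃ : w * star (b * x) = 0 := by simpa using congr_arg star h₂
        rw [mul_assoc, h₁, ← mul_assoc, h₃, mul_zero, zero_mul, add_zero]
      have hc₂ : star (b * x) * (b * x) ∈ Ann (Ann T) := by
        intro w hwT
        have h₁ := hw hb (hz₂ hx hwT)
        have h₂ := hw hb (hz₂ hx (star_mem_Ann_of_nonneg hT hwT))
        have h₃ : w * star (b * x) = 0 := by simpa using congr_arg star h₂
        rw [mul_assoc, h₁, ← mul_assoc, h₃, mul_zero, zero_mul, add_zero]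
      have h₀ := ((mem_Ann_Ann_iff hT).1 hc₂ _ hc₁).1
      rw [← CStarRing.star_mul_self_eq_zero_iff, ← CStarRing.star_mul_self_eq_zero_iff]
      simpa using h₀
    refine fun x hx ↦ (mem_Ann_Ann_iff hU).2 fun b hb ↦ ⟨?_, hmul hx hb⟩
    simpa using congr_arg star
      (hmul (star_mem_Ann_Ann hS hx) (star_mem_Ann_of_nonneg hU hb))
  · rintro W (rfl | rfl)
    exacts [hM₁.2.1 _ (by simp), hM₂.2.1 _ (by simp)]
end

section
/- Let A be a C*-algebra acting on a Hilbert space H, and let V, W, U be annihilators in 𝒫. If V ≈ W and W ≈ U, then V ≈ U; that is, the relation ≈ is transitive on 𝒫. -/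
/-- `V ≈ W`: there is a norm-closed linear subspace `B ⊆ A` with `V₊ = {b b* : b ∈ B}` and
`W₊ = {b* b : b ∈ B}`. -/
def ApproxEquiv {A : Type*} [NonUnitalCStarAlgebra A] [PartialOrder A] (V W : Set A) : Prop :=
  ∃ B : Submodule ℂ A, IsClosed (B : Set A) ∧
    {a ∈ V | 0 ≤ a} = {a : A | ∃ b ∈ B, a = b * star b} ∧
    {a ∈ W | 0 ≤ a} = {a : A | ∃ b ∈ B, a = star b * b}

open Filter Topology

section CStar

variable {A : Type*} [NonUnitalCStarAlgebra A]

lemma norm_mul_eq_of_star_mul_self_eq {x r : A} (h : star x * x = star r * r) (b : A) :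
    ‖x * b‖ = ‖r * b‖ := by
  have key : star (x * b) * (x * b) = star (r * b) * (r * b) := by
    simp only [star_mul, mul_assoc]
    rw [← mul_assoc (star x), h, mul_assoc]
  rw [← mul_self_inj_of_nonneg (norm_nonneg _) (norm_nonneg _),
    ← CStarRing.norm_star_mul_self, ← CStarRing.norm_star_mul_self, key]

lemma norm_mul_sub_self_eq_of_star_mul_self_eq {x r : A} (h : star x * x = star r * r) (b : A) :
    ‖x * b - x‖ = ‖r * b - r‖ := by
  have expand (y : A) : star (y * b - y) * (y * b - y) =
      star b * (star y * y) * b - star b * (star y * y) - star y * y * b + star y * y := by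
    simp only [star_sub, star_mul]
    noncomm_ring
  rw [← mul_self_inj_of_nonneg (norm_nonneg _) (norm_nonneg _),
    ← CStarRing.norm_star_mul_self, ← CStarRing.norm_star_mul_self, expand, expand, h]

variable [PartialOrder A] [StarOrderedRing A]

lemma exists_isSelfAdjoint_tendsto_mul_mul_self {r : A} (hr : 0 ≤ r) :
    ∃ a : ℕ → A, (∀ n, IsSelfAdjoint (a n)) ∧ Tendsto (fun n ↦ r * a n * r) atTop (𝓝 r) := by
  have hδ (n : ℕ) : (0 : ℝ) < 1 / ((n : ℝ) + 1) := by positivity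
  have hc (δ : ℝ) (hδ : 0 < δ) : Continuous fun t : ℝ ↦ t / (t ^ 2 + δ ^ 2) :=
    continuous_id.div (by fun_prop) fun t ↦ by positivity
  refine ⟨fun n ↦ cfcₙ (fun t : ℝ ↦ t / (t ^ 2 + (1 / ((n : ℝ) + 1)) ^ 2)) r,
    fun n ↦ cfcₙ_predicate _ r, ?_⟩
  rw [tendsto_iff_norm_sub_tendsto_zero]
  refine squeeze_zero (fun _ ↦ norm_nonneg _) (fun n ↦ ?_)
    (tendsto_one_div_add_atTop_nhds_zero_nat (𝕜 := ℝ))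
  dsimp only
  generalize hd : 1 / ((n : ℝ) + 1) = δ
  have hδ' : 0 < δ := hd ▸ hδ n
  have hcδ (s : Set ℝ) : ContinuousOn (fun t : ℝ ↦ t / (t ^ 2 + δ ^ 2)) s :=
    (hc δ hδ').continuousOn
  have hid : cfcₙ (fun t : ℝ ↦ t) r = r := cfcₙ_id' ℝ r
  have heq : r * cfcₙ (fun t : ℝ ↦ t / (t ^ 2 + δ ^ 2)) r * r - r =
      cfcₙ (fun t : ℝ ↦ t * (t / (t ^ 2 + δ ^ 2)) * t - t) r := by
    rw [cfcₙ_sub (fun t : ℝ ↦ t * (t / (t ^ 2 + δ ^ 2)) * t) (fun t ↦ t) r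
        (((continuousOn_id' _).mul (hcδ _)).mul (continuousOn_id' _)),
      cfcₙ_mul (fun t : ℝ ↦ t * (t / (t ^ 2 + δ ^ 2))) (fun t ↦ t) r
        ((continuousOn_id' _).mul (hcδ _)),
      cfcₙ_mul (fun t : ℝ ↦ t) (fun t : ℝ ↦ t / (t ^ 2 + δ ^ 2)) r, hid]
  rw [heq]
  refine norm_cfcₙ_le fun t ht ↦ ?_
  have ht0 : 0 ≤ t := quasispectrum_nonneg_of_nonneg r hr t ht
  have hpos : 0 < t ^ 2 + δ ^ 2 := by positivity
  have : t * (t / (t ^ 2 + δ ^ 2)) * t - t = -(δ ^ 2 * t / (t ^ 2 + δ ^ 2)) := by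
    field_simp
    ring
  rw [this, norm_neg, Real.norm_of_nonneg (by positivity), div_le_iff₀ hpos]
  nlinarith [mul_nonneg hδ'.le (sq_nonneg (t - δ)), mul_nonneg hδ'.le (mul_nonneg ht0 hδ'.le)]

/-- The relation `x * star x ∼ star x * x` on positive elements is transitive. -/
lemma exists_mul_star_eq_star_mul_eq {x y : A} (h : star x * x = y * star y) :
    ∃ z : A, z * star z = x * star x ∧ star z * z = star y * y := by
  obtain ⟨r, hr, hrr⟩ : ∃ r : A, 0 ≤ r ∧ r * r = star x * x :=
    ⟨_, CFC.sqrt_nonneg _, CFC.sqrt_mul_sqrt_self _ (star_mul_self_nonneg x)⟩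
  have hrs : star r = r := (IsSelfAdjoint.of_nonneg hr).star_eq
  have hx : star x * x = star r * r := by rw [hrs, hrr]
  have hy : star (star y) * star y = star r * r := by rw [star_star, hrs, hrr, h]
  obtain ⟨a, ha, hlim⟩ := exists_isSelfAdjoint_tendsto_mul_mul_self hr
  have norm_eq (c : A) : ‖x * c * y‖ = ‖r * c * r‖ := by
    rw [mul_assoc, norm_mul_eq_of_star_mul_self_eq hx, ← norm_star, star_mul, star_mul, mul_assoc,
      norm_mul_eq_of_star_mul_self_eq hy, ← norm_star]
    simp [mul_assoc, hrs]
  have tendsto_self {v : A} (hv : star v * v = star r * r) :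
      Tendsto (fun n ↦ v * a n * r) atTop (𝓝 v) := by
    rw [tendsto_iff_norm_sub_tendsto_zero] at hlim ⊢
    refine hlim.congr fun n ↦ ?_
    rw [mul_assoc, mul_assoc, norm_mul_sub_self_eq_of_star_mul_self_eq hv]
  have hcauchy : CauchySeq fun n ↦ x * a n * y := by
    have := hlim.cauchySeq
    rw [Metric.cauchySeq_iff] at this ⊢
    have hdist (m n : ℕ) : dist (x * a m * y) (x * a n * y) =
        dist (r * a m * r) (r * a n * r) := by
      simp only [dist_eq_norm, ← sub_mul, ← mul_sub, norm_eq]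
    simpa only [hdist] using this
  obtain ⟨z, hz⟩ := cauchySeq_tendsto_of_complete hcauchy
  refine ⟨z, tendsto_nhds_unique (hz.mul hz.star) ?_, tendsto_nhds_unique (hz.star.mul hz) ?_⟩
  · refine ((tendsto_self hx).mul (tendsto_self hx).star).congr fun n ↦ ?_
    simp only [star_mul, (ha n).star_eq, hrs, mul_assoc]
    rw [← mul_assoc r r, hrr, h]
    simp only [mul_assoc]
  · have := ((tendsto_self hy).mul (tendsto_self hy).star)
    rw [star_star] at this
    refine this.congr fun n ↦ ?_
    simp only [star_mul, (ha n).star_eq, hrs, mul_assoc, star_star]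
    rw [← mul_assoc r r, hrr]
    simp only [mul_assoc]

lemma mul_eq_zero_of_anticommute {a s : A} (hs : 0 ≤ s) (h : a * s + s * a = 0) :
    a * s = 0 ∧ s * a = 0 := by
  have has : a * s = -(s * a) := eq_neg_of_add_eq_zero_left h
  have hcomm : Commute (s * s) a := by
    rw [commute_iff_eq, ← mul_assoc, has, neg_mul, mul_assoc s a s, has, mul_neg, neg_neg, mul_assoc]
  have hcomm' : Commute s a := by
    have := hcomm.cfcₙ_nnreal NNReal.sqrt
    rwa [← CFC.sqrt, CFC.sqrt_mul_self s hs] at this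
  have : s * a = 0 := by
    have h2 : (2 : ℂ) • (s * a) = 0 := by
      rw [two_smul, add_eq_zero_iff_eq_neg, ← has, hcomm'.eq]
    exact (smul_eq_zero.1 h2).resolve_left two_ne_zero
  exact ⟨by rw [has, this, neg_zero], this⟩

lemma mem_Ann_iff {S : Set A} (hS : ∀ s ∈ S, 0 ≤ s) {a : A} :
    a ∈ Ann S ↔ ∀ s ∈ S, a * s = 0 ∧ s * a = 0 :=
  ⟨fun h s hs ↦ mul_eq_zero_of_anticommute (hS s hs) (h s hs),
    fun h s hs ↦ by rw [(h s hs).1, (h s hs).2, add_zero]⟩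

lemma star_mem_Ann {S : Set A} (hS : ∀ s ∈ S, 0 ≤ s) {a : A} (ha : a ∈ Ann S) :
    star a ∈ Ann S := fun s hs ↦ by
  have := congrArg star (ha s hs)
  rwa [star_add, star_mul, star_mul, (IsSelfAdjoint.of_nonneg (hS s hs)).star_eq, star_zero,
    add_comm] at this

lemma star_mul_self_mem_Ann {S : Set A} (hS : ∀ s ∈ S, 0 ≤ s) {a : A} (ha : a ∈ Ann S) :
    star a * a ∈ Ann S := by
  rw [mem_Ann_iff hS]
  intro s hs
  have h₁ := ((mem_Ann_iff hS).1 ha s hs).1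
  have h₂ := ((mem_Ann_iff hS).1 (star_mem_Ann hS ha) s hs).2
  exact ⟨by rw [mul_assoc, h₁, mul_zero], by rw [← mul_assoc, h₂, zero_mul]⟩

lemma mul_star_self_mem_Ann_Ann_iff {S : Set A} (hS : ∀ s ∈ S, 0 ≤ s) {x : A} :
    x * star x ∈ Ann (Ann S) ↔ ∀ t ∈ Ann S, t * x = 0 := by
  refine ⟨fun h t ht ↦ ?_, fun h t ht ↦ ?_⟩
  · have h0 := (mul_eq_zero_of_anticommute (star_mul_self_nonneg t)
      (h _ (star_mul_self_mem_Ann hS ht))).2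
    have h1 : star (t * (x * star x)) * (t * (x * star x)) = 0 := by
      rw [star_mul, mul_assoc, ← mul_assoc (star t), h0, mul_zero]
    have h2 : t * (x * star x) = 0 := CStarRing.star_mul_self_eq_zero_iff _ |>.1 h1
    refine CStarRing.mul_star_self_eq_zero_iff _ |>.1 ?_
    rw [star_mul, mul_assoc, ← mul_assoc x, ← mul_assoc t, h2, zero_mul]
  · have h1 : star x * t = 0 := by
      simpa using congrArg star (h _ (star_mem_Ann hS ht))
    rw [mul_assoc, h1, ← mul_assoc, h t ht, mul_zero, zero_mul, add_zero]

lemma star_mul_self_mem_Ann_Ann_iff {S : Set A} (hS : ∀ s ∈ S, 0 ≤ s) {x : A} :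
    star x * x ∈ Ann (Ann S) ↔ ∀ t ∈ Ann S, x * t = 0 := by
  have := mul_star_self_mem_Ann_Ann_iff hS (x := star x)
  rw [star_star] at this
  rw [this]
  refine ⟨fun h t ht ↦ ?_, fun h t ht ↦ ?_⟩ <;>
    simpa using congrArg star (h _ (star_mem_Ann hS ht))

/-- For `T R : Set A`, the closed subspace of those `x` with `T * x = 0` and `x * R = 0`. -/
def annihilatedSubmodule (T R : Set A) : Submodule ℂ A where
  carrier := {x | (∀ t ∈ T, t * x = 0) ∧ ∀ t ∈ R, x * t = 0}
  zero_mem' := by simp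
  add_mem' hx hy := ⟨fun t ht ↦ by rw [mul_add, hx.1 t ht, hy.1 t ht, add_zero],
    fun t ht ↦ by rw [add_mul, hx.2 t ht, hy.2 t ht, add_zero]⟩
  smul_mem' c x hx := ⟨fun t ht ↦ by rw [mul_smul_comm, hx.1 t ht, smul_zero],
    fun t ht ↦ by rw [smul_mul_assoc, hx.2 t ht, smul_zero]⟩

omit [PartialOrder A] [StarOrderedRing A] in
lemma isClosed_annihilatedSubmodule (T R : Set A) :
    IsClosed (annihilatedSubmodule T R : Set A) := by
  have : (annihilatedSubmodule T R : Set A) =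
      (⋂ t ∈ T, {x | t * x = 0}) ∩ ⋂ t ∈ R, {x | x * t = 0} := by
    ext x
    simp [annihilatedSubmodule]
  rw [this]
  exact (isClosed_biInter fun t _ ↦ isClosed_eq (by fun_prop) continuous_const).inter
    (isClosed_biInter fun t _ ↦ isClosed_eq (by fun_prop) continuous_const)

lemma approxEquiv_of_forall_exists {V W : Set A} (hV : V ∈ PAnn A) (hW : W ∈ PAnn A)
    (h₁ : ∀ v ∈ V, 0 ≤ v → ∃ x : A, x * star x = v ∧ star x * x ∈ W)
    (h₂ : ∀ w ∈ W, 0 ≤ w → ∃ x : A, star x * x = w ∧ x * star x ∈ V) : ApproxEquiv V W := by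
  obtain ⟨S, hS, rfl⟩ := hV
  obtain ⟨R, hR, rfl⟩ := hW
  have hmem (x : A) : x ∈ annihilatedSubmodule (Ann S) (Ann R) ↔
      x * star x ∈ Ann (Ann S) ∧ star x * x ∈ Ann (Ann R) := by
    rw [mul_star_self_mem_Ann_Ann_iff hS, star_mul_self_mem_Ann_Ann_iff hR]
    rfl
  refine ⟨_, isClosed_annihilatedSubmodule (Ann S) (Ann R), ?_, ?_⟩
  · ext v
    refine ⟨fun ⟨hv, hv0⟩ ↦ ?_, ?_⟩
    · obtain ⟨x, rfl, hx⟩ := h₁ v hv hv0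
      exact ⟨x, (hmem x).2 ⟨hv, hx⟩, rfl⟩
    · rintro ⟨x, hx, rfl⟩
      exact ⟨((hmem x).1 hx).1, mul_star_self_nonneg x⟩
  · ext w
    refine ⟨fun ⟨hw, hw0⟩ ↦ ?_, ?_⟩
    · obtain ⟨x, rfl, hx⟩ := h₂ w hw hw0
      exact ⟨x, (hmem x).2 ⟨hx, hw⟩, rfl⟩
    · rintro ⟨x, hx, rfl⟩
      exact ⟨((hmem x).1 hx).2, star_mul_self_nonneg x⟩

omit [StarOrderedRing A] in
lemma ApproxEquiv.exists_mul_star_eq {V W : Set A} (h : ApproxEquiv V W) {v : A} (hv : v ∈ V)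
    (hv0 : 0 ≤ v) : ∃ x : A, x * star x = v ∧ star x * x ∈ W := by
  obtain ⟨B, -, hBV, hBW⟩ := h
  obtain ⟨x, hx, rfl⟩ : v ∈ {a : A | ∃ b ∈ B, a = b * star b} := hBV ▸ ⟨hv, hv0⟩
  have : star x * x ∈ {a ∈ W | 0 ≤ a} := hBW ▸ ⟨x, hx, rfl⟩
  exact ⟨x, rfl, this.1⟩

omit [StarOrderedRing A] in
lemma ApproxEquiv.exists_star_mul_eq {V W : Set A} (h : ApproxEquiv V W) {w : A} (hw : w ∈ W)
    (hw0 : 0 ≤ w) : ∃ x : A, star x * x = w ∧ x * star x ∈ V := by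
  obtain ⟨B, -, hBV, hBW⟩ := h
  obtain ⟨x, hx, rfl⟩ : w ∈ {a : A | ∃ b ∈ B, a = star b * b} := hBW ▸ ⟨hw, hw0⟩
  have : x * star x ∈ {a ∈ V | 0 ≤ a} := hBV ▸ ⟨x, hx, rfl⟩
  exact ⟨x, rfl, this.1⟩

end CStar

/-- The relation `≈` is transitive on the lattice `𝒫` of annihilators. -/
theorem stmt_15 {A : Type*} [NonUnitalCStarAlgebra A] [PartialOrder A] [StarOrderedRing A]
    (V W U : Set A) (hV : V ∈ PAnn A) (hW : W ∈ PAnn A) (hU : U ∈ PAnn A)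
    (h₁ : ApproxEquiv V W) (h₂ : ApproxEquiv W U) : ApproxEquiv V U := by
  refine approxEquiv_of_forall_exists hV hU (fun v hv hv0 ↦ ?_) fun u hu hu0 ↦ ?_
  · obtain ⟨x, rfl, hx⟩ := h₁.exists_mul_star_eq hv hv0
    obtain ⟨y, hy, hyU⟩ := h₂.exists_mul_star_eq hx (star_mul_self_nonneg x)
    obtain ⟨z, hzx, hzy⟩ := exists_mul_star_eq_star_mul_eq hy.symm
    exact ⟨z, hzx, hzy ▸ hyU⟩
  · obtain ⟨y, rfl, hy⟩ := h₂.exists_star_mul_eq hu hu0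
    obtain ⟨x, hx, hxV⟩ := h₁.exists_star_mul_eq hy (mul_star_self_nonneg y)
    obtain ⟨z, hzx, hzy⟩ := exists_mul_star_eq_star_mul_eq hx
    exact ⟨z, hzy, hzx ▸ hxV⟩
end
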